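/- arXiv:1112.2455 — 2 statements merged into one kernel-verified Lean document; each statement's English description precedes it below -/
import Mathlib

section
/- There exist a real number c and a derivation D of 𝔤₅ such that Ric = c·Id + D if and only if either (β, γ) ≠ (0, 0) and α² + β² = γ² + δ², or (β, γ) = (0, 0). Moreover, in the first case the unique such pair is c = α² + δ² + (β + γ)²/2 and D given by D e₁ = (αδ − βγ − α² − β²) e₁, D e₂ = (αδ − βγ − α² − β²) e₂, D e₃ = 0; in the second case the unique such pair is c = α² + δ² and D given by D e₁ = δ(α − δ) e₁, D e₂ = α(δ − α) e₂, D e₃ = 0. -/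
/-- Bracket of the Lie algebra 𝔤₅ in coordinates w.r.t. the basis {e₁,e₂,e₃}:
[e₁,e₂] = 0, [e₁,e₃] = α e₁ + β e₂, [e₂,e₃] = γ e₁ + δ e₂. -/
noncomputable def g5bra (α β γ δ : ℝ) (X Y : Fin 3 → ℝ) : Fin 3 → ℝ :=
  ![(X 0 * Y 2 - X 2 * Y 0) * α + (X 1 * Y 2 - X 2 * Y 1) * γ,
    (X 0 * Y 2 - X 2 * Y 0) * β + (X 1 * Y 2 - X 2 * Y 1) * δ,
    0]

/-- `D` is a derivation of 𝔤₅. -/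
def g5IsDeriv (α β γ δ : ℝ) (D : (Fin 3 → ℝ) →ₗ[ℝ] (Fin 3 → ℝ)) : Prop :=
  ∀ X Y, D (g5bra α β γ δ X Y) = g5bra α β γ δ (D X) Y + g5bra α β γ δ X (D Y)

/-- The Ricci operator of (G₅, g). -/
noncomputable def g5Ric (α β γ δ : ℝ) : (Fin 3 → ℝ) →ₗ[ℝ] (Fin 3 → ℝ) :=
  Matrix.toLin' (Matrix.diagonal
    ![α ^ 2 + α * δ + (β ^ 2 - γ ^ 2) / 2,
      α * δ + δ ^ 2 - (β ^ 2 - γ ^ 2) / 2,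
      α ^ 2 + δ ^ 2 + (β + γ) ^ 2 / 2])

theorem linearMap_fin_three_apply (D : (Fin 3 → ℝ) →ₗ[ℝ] (Fin 3 → ℝ)) (X : Fin 3 → ℝ) :
    D X = X 0 • D ![1, 0, 0] + X 1 • D ![0, 1, 0] + X 2 • D ![0, 0, 1] := by
  simp only [← map_smul, ← map_add]
  congr 1
  ext i
  fin_cases i <;> simp

theorem g5Ric_apply (α β γ δ : ℝ) (X : Fin 3 → ℝ) :
    g5Ric α β γ δ X = ![(α ^ 2 + α * δ + (β ^ 2 - γ ^ 2) / 2) * X 0,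
      (α * δ + δ ^ 2 - (β ^ 2 - γ ^ 2) / 2) * X 1,
      (α ^ 2 + δ ^ 2 + (β + γ) ^ 2 / 2) * X 2] := by
  ext i
  fin_cases i <;> simp [g5Ric, Matrix.mulVec_diagonal]

/-- The soliton equation `Ric = c • id + D` evaluated on the standard basis. -/
theorem g5Ric_eq_iff (α β γ δ c : ℝ) (D : (Fin 3 → ℝ) →ₗ[ℝ] (Fin 3 → ℝ)) :
    g5Ric α β γ δ = c • (LinearMap.id : (Fin 3 → ℝ) →ₗ[ℝ] (Fin 3 → ℝ)) + D ↔
      D ![1, 0, 0] = (α ^ 2 + α * δ + (β ^ 2 - γ ^ 2) / 2 - c) • (![1, 0, 0] : Fin 3 → ℝ) ∧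
      D ![0, 1, 0] = (α * δ + δ ^ 2 - (β ^ 2 - γ ^ 2) / 2 - c) • (![0, 1, 0] : Fin 3 → ℝ) ∧
      D ![0, 0, 1] = (α ^ 2 + δ ^ 2 + (β + γ) ^ 2 / 2 - c) • (![0, 0, 1] : Fin 3 → ℝ) := by
  constructor
  · intro h
    have hD : D = g5Ric α β γ δ - c • LinearMap.id := by rw [h]; abel
    subst hD
    refine ⟨?_, ?_, ?_⟩ <;> ext i <;> fin_cases i <;> simp [g5Ric_apply]
  · rintro ⟨h₁, h₂, h₃⟩
    refine LinearMap.ext fun X => ?_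
    rw [LinearMap.add_apply, linearMap_fin_three_apply D X, h₁, h₂, h₃, g5Ric_apply]
    ext i
    fin_cases i <;> simp <;> ring

/-- An endomorphism that is diagonal in the standard basis is a derivation of `𝔤₅` iff it
respects the brackets `[e₁, e₃]` and `[e₂, e₃]`. -/
theorem g5IsDeriv_iff_of_diagonal {α β γ δ d₁ d₂ d₃ : ℝ}
    {D : (Fin 3 → ℝ) →ₗ[ℝ] (Fin 3 → ℝ)}
    (hD₁ : D ![1, 0, 0] = d₁ • (![1, 0, 0] : Fin 3 → ℝ))
    (hD₂ : D ![0, 1, 0] = d₂ • (![0, 1, 0] : Fin 3 → ℝ))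
    (hD₃ : D ![0, 0, 1] = d₃ • (![0, 0, 1] : Fin 3 → ℝ)) :
    g5IsDeriv α β γ δ D ↔
      α * d₃ = 0 ∧ δ * d₃ = 0 ∧ β * (d₂ - d₁ - d₃) = 0 ∧ γ * (d₁ - d₂ - d₃) = 0 := by
  have hD (X : Fin 3 → ℝ) : D X = ![d₁ * X 0, d₂ * X 1, d₃ * X 2] := by
    rw [linearMap_fin_three_apply D X, hD₁, hD₂, hD₃]
    ext i
    fin_cases i <;> simp [mul_comm]
  constructor
  · intro h
    have h₁₃ := h ![1, 0, 0] ![0, 0, 1]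
    have h₂₃ := h ![0, 1, 0] ![0, 0, 1]
    have a := congrFun h₁₃ 0
    have b := congrFun h₁₃ 1
    have c := congrFun h₂₃ 0
    have d := congrFun h₂₃ 1
    simp [hD, g5bra] at a b c d
    exact ⟨mul_eq_zero.2 a.symm, mul_eq_zero.2 d.symm, by linarith, by linarith⟩
  · rintro ⟨a, d, b, c⟩ X Y
    ext i
    fin_cases i <;> simp [hD, g5bra]
    · linear_combination (X 2 * Y 0 - X 0 * Y 2) * a + (X 1 * Y 2 - X 2 * Y 1) * c
    · linear_combination (X 0 * Y 2 - X 2 * Y 0) * b + (X 2 * Y 1 - X 1 * Y 2) * d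

/-- `(c, D)` solves the soliton equation on `𝔤₅` iff `D = Ric - c • id`, `c` is the eigenvalue of
`Ric` on `e₃`, and the eigenvalues on `e₁` and `e₂` agree unless `β = γ = 0`. -/
theorem g5_soliton_iff {α β γ δ : ℝ} (hαδ : α + δ ≠ 0) (c : ℝ)
    (D : (Fin 3 → ℝ) →ₗ[ℝ] (Fin 3 → ℝ)) :
    (g5IsDeriv α β γ δ D ∧
      g5Ric α β γ δ = c • (LinearMap.id : (Fin 3 → ℝ) →ₗ[ℝ] (Fin 3 → ℝ)) + D) ↔
    g5Ric α β γ δ = c • (LinearMap.id : (Fin 3 → ℝ) →ₗ[ℝ] (Fin 3 → ℝ)) + D ∧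
      c = α ^ 2 + δ ^ 2 + (β + γ) ^ 2 / 2 ∧
      ((β = 0 ∧ γ = 0) ∨ α ^ 2 + β ^ 2 = γ ^ 2 + δ ^ 2) := by
  rw [and_comm]
  refine and_congr_right fun h => ?_
  obtain ⟨h₁, h₂, h₃⟩ := (g5Ric_eq_iff α β γ δ c D).1 h
  rw [g5IsDeriv_iff_of_diagonal h₁ h₂ h₃]
  constructor
  · rintro ⟨a, d, hβ, hγ⟩
    have hc : c = α ^ 2 + δ ^ 2 + (β + γ) ^ 2 / 2 := by
      apply mul_left_cancel₀ hαδ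
      linear_combination -a - d
    refine ⟨hc, ?_⟩
    subst hc
    by_cases heq : α ^ 2 + β ^ 2 = γ ^ 2 + δ ^ 2
    · exact Or.inr heq
    · have hne := sub_ne_zero.2 heq
      refine Or.inl ⟨mul_right_cancel₀ hne ?_, mul_right_cancel₀ hne ?_⟩
      · linear_combination -hβ
      · linear_combination hγ
  · rintro ⟨rfl, ⟨rfl, rfl⟩ | heq⟩
    · simp
    · refine ⟨by ring, by ring, ?_, ?_⟩
      · linear_combination -β * heq
      · linear_combination γ * heq

theorem stmt14 (α β γ δ : ℝ) (h1 : α + δ ≠ 0) (h2 : α * γ + β * δ = 0) :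
    ((∃ (c : ℝ) (D : (Fin 3 → ℝ) →ₗ[ℝ] (Fin 3 → ℝ)), g5IsDeriv α β γ δ D ∧
        g5Ric α β γ δ = c • (LinearMap.id : (Fin 3 → ℝ) →ₗ[ℝ] (Fin 3 → ℝ)) + D) ↔
      ((¬(β = 0 ∧ γ = 0) ∧ α ^ 2 + β ^ 2 = γ ^ 2 + δ ^ 2) ∨ (β = 0 ∧ γ = 0))) ∧
    (¬(β = 0 ∧ γ = 0) → α ^ 2 + β ^ 2 = γ ^ 2 + δ ^ 2 →
      ∀ (c : ℝ) (D : (Fin 3 → ℝ) →ₗ[ℝ] (Fin 3 → ℝ)),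
        (g5IsDeriv α β γ δ D ∧
          g5Ric α β γ δ = c • (LinearMap.id : (Fin 3 → ℝ) →ₗ[ℝ] (Fin 3 → ℝ)) + D) ↔
        (c = α ^ 2 + δ ^ 2 + (β + γ) ^ 2 / 2 ∧
          D ![1, 0, 0] = (α * δ - β * γ - α ^ 2 - β ^ 2) • (![1, 0, 0] : Fin 3 → ℝ) ∧
          D ![0, 1, 0] = (α * δ - β * γ - α ^ 2 - β ^ 2) • (![0, 1, 0] : Fin 3 → ℝ) ∧
          D ![0, 0, 1] = 0)) ∧
    (β = 0 → γ = 0 →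
      ∀ (c : ℝ) (D : (Fin 3 → ℝ) →ₗ[ℝ] (Fin 3 → ℝ)),
        (g5IsDeriv α β γ δ D ∧
          g5Ric α β γ δ = c • (LinearMap.id : (Fin 3 → ℝ) →ₗ[ℝ] (Fin 3 → ℝ)) + D) ↔
        (c = α ^ 2 + δ ^ 2 ∧
          D ![1, 0, 0] = (δ * (α - δ)) • (![1, 0, 0] : Fin 3 → ℝ) ∧
          D ![0, 1, 0] = (α * (δ - α)) • (![0, 1, 0] : Fin 3 → ℝ) ∧
          D ![0, 0, 1] = 0)) := by
  refine ⟨⟨?_, fun h => ?_⟩, fun hβγ heq c D => ?_, fun hβ hγ c D => ?_⟩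
  · rintro ⟨c, D, h⟩
    have := ((g5_soliton_iff h1 c D).1 h).2.2
    tauto
  · refine ⟨α ^ 2 + δ ^ 2 + (β + γ) ^ 2 / 2,
      g5Ric α β γ δ - (α ^ 2 + δ ^ 2 + (β + γ) ^ 2 / 2) • LinearMap.id,
      (g5_soliton_iff h1 _ _).2 ⟨by abel, rfl, by tauto⟩⟩
  · rw [g5_soliton_iff h1, g5Ric_eq_iff, and_comm, and_assoc]
    refine and_congr_right fun hc => ?_
    have e₁ : α ^ 2 + α * δ + (β ^ 2 - γ ^ 2) / 2 - c = α * δ - β * γ - α ^ 2 - β ^ 2 := by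
      linear_combination heq - hc
    have e₂ : α * δ + δ ^ 2 - (β ^ 2 - γ ^ 2) / 2 - c = α * δ - β * γ - α ^ 2 - β ^ 2 := by
      linear_combination -hc
    have e₃ : α ^ 2 + δ ^ 2 + (β + γ) ^ 2 / 2 - c = 0 := by linear_combination -hc
    rw [e₁, e₂, e₃, zero_smul]
    tauto
  · subst hβ hγ
    have e : α ^ 2 + δ ^ 2 + (0 + 0) ^ 2 / 2 = α ^ 2 + δ ^ 2 := by ring
    rw [g5_soliton_iff h1, g5Ric_eq_iff, and_comm, and_assoc, e]
    refine and_congr_right fun hc => ?_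
    have e₁ : α ^ 2 + α * δ + (0 ^ 2 - 0 ^ 2) / 2 - c = δ * (α - δ) := by
      linear_combination -hc
    have e₂ : α * δ + δ ^ 2 - (0 ^ 2 - 0 ^ 2) / 2 - c = α * (δ - α) := by
      linear_combination -hc
    have e₃ : α ^ 2 + δ ^ 2 - c = 0 := by linear_combination -hc
    rw [e₁, e₂, e₃, zero_smul]
    tauto
end

section
/- Let D be a linear endomorphism of 𝔤₆. (i) If (β, γ) ≠ (0, 0): D is a derivation if and only if there exist real numbers u, v, r, k with D e₁ = u e₂ + v e₃, D e₂ = r e₂ + β k e₃, D e₃ = γ k e₂ + (r + (δ − α) k) e₃. (ii) If (β, γ) = (0, 0) and δ ≠ α: D is a derivation if and only if there exist u, v, r, s with D e₁ = u e₂ + v e₃, D e₂ = r e₂, D e₃ = s e₃. (iii) If (β, γ) = (0, 0) and δ = α: D is a derivation if and only if the image of D is contained in the span of e₂ and e₃. -/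
/-- Bracket of the Lie algebra 𝔤₆ in coordinates w.r.t. the basis {e₁,e₂,e₃}:
[e₁,e₂] = α e₂ + β e₃, [e₁,e₃] = γ e₂ + δ e₃, [e₂,e₃] = 0. -/
noncomputable def g6bra (α β γ δ : ℝ) (X Y : Fin 3 → ℝ) : Fin 3 → ℝ :=
  ![0,
    (X 0 * Y 1 - X 1 * Y 0) * α + (X 0 * Y 2 - X 2 * Y 0) * γ,
    (X 0 * Y 1 - X 1 * Y 0) * β + (X 0 * Y 2 - X 2 * Y 0) * δ]

/-- `D` is a derivation of 𝔤₆. -/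
def g6IsDeriv (α β γ δ : ℝ) (D : (Fin 3 → ℝ) →ₗ[ℝ] (Fin 3 → ℝ)) : Prop :=
  ∀ X Y, D (g6bra α β γ δ X Y) = g6bra α β γ δ (D X) Y + g6bra α β γ δ X (D Y)

theorem LinearMap.apply_fin_three (D : (Fin 3 → ℝ) →ₗ[ℝ] (Fin 3 → ℝ)) (X : Fin 3 → ℝ)
    (i : Fin 3) :
    D X i = X 0 * D ![1, 0, 0] i + X 1 * D ![0, 1, 0] i + X 2 * D ![0, 0, 1] i := by
  have hX : X = X 0 • ![1, 0, 0] + X 1 • ![0, 1, 0] + X 2 • ![0, 0, 1] := by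
    ext j
    fin_cases j <;> simp
  conv_lhs => rw [hX]
  simp only [map_add, map_smul, Pi.add_apply, Pi.smul_apply, smul_eq_mul]

theorem vec_fin_three_eq_iff (v : Fin 3 → ℝ) (a b c : ℝ) :
    v = ![a, b, c] ↔ v 0 = a ∧ v 1 = b ∧ v 2 = c := by
  simp [funext_iff, Fin.forall_fin_succ]

/-- A derivation of `𝔤₆` maps into the span of `e₂, e₃`, and its restriction to that span commutes
with `ad e₁`. -/
theorem g6IsDeriv_iff {α β γ δ : ℝ} (h : α + δ ≠ 0) (D : (Fin 3 → ℝ) →ₗ[ℝ] (Fin 3 → ℝ)) :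
    g6IsDeriv α β γ δ D ↔
      (D ![1, 0, 0] 0 = 0 ∧ D ![0, 1, 0] 0 = 0 ∧ D ![0, 0, 1] 0 = 0) ∧
      β * D ![0, 0, 1] 1 = γ * D ![0, 1, 0] 2 ∧
      β * (D ![0, 0, 1] 2 - D ![0, 1, 0] 1) = (δ - α) * D ![0, 1, 0] 2 ∧
      γ * (D ![0, 0, 1] 2 - D ![0, 1, 0] 1) = (δ - α) * D ![0, 0, 1] 1 := by
  constructor
  · intro hD
    have key := fun X Y i => congrFun (hD X Y) i
    simp only [D.apply_fin_three (g6bra _ _ _ _ _ _)] at key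
    have h12 := key ![1, 0, 0] ![0, 1, 0]
    have h13 := key ![1, 0, 0] ![0, 0, 1]
    have h23 := key ![0, 1, 0] ![0, 0, 1]
    simp [g6bra, Fin.forall_fin_succ] at h12 h13 h23
    obtain ⟨a0, a1, a2⟩ := h12
    obtain ⟨b0, b1, b2⟩ := h13
    obtain ⟨c1, c2⟩ := h23
    have hp : D ![1, 0, 0] 0 = 0 := by
      refine (mul_eq_zero.mp ?_).resolve_right h
      linear_combination -a1 - b2
    have hq : D ![0, 1, 0] 0 = 0 := by
      refine (mul_eq_zero.mp ?_).resolve_right h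
      linear_combination a0 - c2
    have hr : D ![0, 0, 1] 0 = 0 := by
      refine (mul_eq_zero.mp ?_).resolve_right h
      linear_combination b0 + c1
    rw [hp] at a1 a2 b1 b2
    refine ⟨⟨hp, hq, hr⟩, ?_, ?_, ?_⟩
    · linear_combination a1
    · linear_combination a2
    · linear_combination -b1
  · rintro ⟨⟨hp, hq, hr⟩, e1, e2, e3⟩ X Y
    ext i
    rw [D.apply_fin_three]
    fin_cases i
    · simp [g6bra, hp, hq, hr]
    · simp [g6bra, D.apply_fin_three X, D.apply_fin_three Y, hp, hq, hr]
      linear_combination (X 0 * Y 1 - X 1 * Y 0) * e1 - (X 0 * Y 2 - X 2 * Y 0) * e3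
    · simp [g6bra, D.apply_fin_three X, D.apply_fin_three Y, hp, hq, hr]
      linear_combination (X 0 * Y 1 - X 1 * Y 0) * e2 - (X 0 * Y 2 - X 2 * Y 0) * e1

theorem mem_span_e₂_e₃_iff (v : Fin 3 → ℝ) :
    v ∈ Submodule.span ℝ {(![0, 1, 0] : Fin 3 → ℝ), (![0, 0, 1] : Fin 3 → ℝ)} ↔ v 0 = 0 := by
  rw [Submodule.mem_span_pair]
  constructor
  · rintro ⟨a, b, rfl⟩
    simp
  · intro hv
    refine ⟨v 1, v 2, ?_⟩
    ext i
    fin_cases i <;> simp [hv]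

theorem stmt15 (α β γ δ : ℝ) (h1 : α + δ ≠ 0) (h2 : α * γ - β * δ = 0)
    (D : (Fin 3 → ℝ) →ₗ[ℝ] (Fin 3 → ℝ)) :
    (¬(β = 0 ∧ γ = 0) → (g6IsDeriv α β γ δ D ↔ ∃ u v r k : ℝ,
        D ![1, 0, 0] = ![0, u, v] ∧
        D ![0, 1, 0] = ![0, r, β * k] ∧
        D ![0, 0, 1] = ![0, γ * k, r + (δ - α) * k])) ∧
    (β = 0 → γ = 0 → δ ≠ α → (g6IsDeriv α β γ δ D ↔ ∃ u v r s : ℝ,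
        D ![1, 0, 0] = ![0, u, v] ∧
        D ![0, 1, 0] = ![0, r, 0] ∧
        D ![0, 0, 1] = ![0, 0, s])) ∧
    (β = 0 → γ = 0 → δ = α → (g6IsDeriv α β γ δ D ↔
        LinearMap.range D ≤ Submodule.span ℝ
          {(![0, 1, 0] : Fin 3 → ℝ), (![0, 0, 1] : Fin 3 → ℝ)})) := by
  rw [g6IsDeriv_iff h1]
  simp only [vec_fin_three_eq_iff]
  refine ⟨fun hne => ⟨?_, ?_⟩, fun hβ hγ hne => ⟨?_, ?_⟩, fun hβ hγ heq => ⟨?_, ?_⟩⟩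
  · rintro ⟨⟨hp, hq, hr⟩, e1, e2, e3⟩
    obtain ⟨k, hk2, hk1, hk⟩ : ∃ k, D ![0, 1, 0] 2 = β * k ∧ D ![0, 0, 1] 1 = γ * k ∧
        D ![0, 0, 1] 2 - D ![0, 1, 0] 1 = (δ - α) * k := by
      by_cases hβ : β = 0
      · have hγ : γ ≠ 0 := fun hγ => hne ⟨hβ, hγ⟩
        refine ⟨D ![0, 0, 1] 1 / γ, ?_, ?_, ?_⟩ <;> field_simp <;> linarith
      · refine ⟨D ![0, 1, 0] 2 / β, ?_, ?_, ?_⟩ <;> field_simp <;> linarith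
    exact ⟨D ![1, 0, 0] 1, D ![1, 0, 0] 2, D ![0, 1, 0] 1, k, ⟨hp, rfl, rfl⟩, ⟨hq, rfl, hk2⟩,
      hr, hk1, by linarith⟩
  · rintro ⟨u, v, r, k, ⟨hp, -, -⟩, ⟨hq, hb, hc⟩, hr, he, hf⟩
    rw [hb, hc, he, hf]
    exact ⟨⟨hp, hq, hr⟩, by ring, by ring, by ring⟩
  · rintro ⟨⟨hp, hq, hr⟩, -, e2, e3⟩
    rw [hβ, zero_mul, zero_eq_mul] at e2
    rw [hγ, zero_mul, zero_eq_mul] at e3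
    exact ⟨_, _, _, _, ⟨hp, rfl, rfl⟩, ⟨hq, rfl, e2.resolve_left (sub_ne_zero.mpr hne)⟩,
      hr, e3.resolve_left (sub_ne_zero.mpr hne), rfl⟩
  · rintro ⟨u, v, r, s, ⟨hp, -, -⟩, ⟨hq, hb, hc⟩, hr, he, hf⟩
    simp [hp, hq, hr, hc, he, hβ, hγ]
  · rintro ⟨⟨hp, hq, hr⟩, -⟩ _ ⟨X, rfl⟩
    rw [mem_span_e₂_e₃_iff, D.apply_fin_three, hp, hq, hr]
    ring
  · intro hD
    have hD0 : ∀ X, D X 0 = 0 := fun X => (mem_span_e₂_e₃_iff _).mp (hD ⟨X, rfl⟩)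
    simp [hD0, hβ, hγ, heq]
end
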